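/- Let L and M be lattices in ℤ^d (full-rank subgroups of ℤ^d) with the same index in ℤ^d, i.e., [ℤ^d : L] = [ℤ^d : M] = k < ∞. Then there exists a finite set F ⊆ ℤ^d of cardinality k such that L ⊕ F = ℤ^d and M ⊕ F = ℤ^d are both tilings; that is, every element of ℤ^d is uniquely a sum ℓ + f with ℓ ∈ L, f ∈ F, and uniquely a sum m + f' with m ∈ M, f' ∈ F. -/

import Mathlib

/-- Two subgroups of the same finite index in an abelian group have cosets that can be paired
off so that paired cosets intersect. -/
lemma exists_quotient_equiv_with_common_representatives {G : Type*} [AddCommGroup G]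
    (L M : AddSubgroup G) (hL : L.index ≠ 0) (h : L.index = M.index) :
    ∃ e : G ⧸ L ≃ G ⧸ M, ∀ a, ∃ g : G, (g : G ⧸ L) = a ∧ (g : G ⧸ M) = e a := by
  have hLS : L ≤ L ⊔ M := le_sup_left
  have hMS : M ≤ L ⊔ M := le_sup_right
  have hLi := AddSubgroup.relIndex_mul_index hLS
  have hMi := AddSubgroup.relIndex_mul_index hMS
  have hS : (L ⊔ M).index ≠ 0 := fun h0 => hL (by rw [← hLi, h0, mul_zero])
  have hr : L.relIndex (L ⊔ M) = M.relIndex (L ⊔ M) :=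
    Nat.eq_of_mul_eq_mul_right (Nat.pos_of_ne_zero hS) (by rw [hLi, hMi, h])
  have hrL : L.relIndex (L ⊔ M) ≠ 0 := fun h0 => hL (by rw [← hLi, h0, zero_mul])
  have : Finite ((L ⊔ M : AddSubgroup G) ⧸ L.addSubgroupOf (L ⊔ M)) :=
    Nat.finite_of_card_ne_zero hrL
  have : Finite ((L ⊔ M : AddSubgroup G) ⧸ M.addSubgroupOf (L ⊔ M)) :=
    Nat.finite_of_card_ne_zero fun h0 => hrL (hr.trans h0)
  let f : ((L ⊔ M : AddSubgroup G) ⧸ L.addSubgroupOf (L ⊔ M)) ≃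
      ((L ⊔ M : AddSubgroup G) ⧸ M.addSubgroupOf (L ⊔ M)) := (Finite.card_eq.1 hr).some
  let eL := AddSubgroup.quotientEquivProdOfLE hLS
  let eM := AddSubgroup.quotientEquivProdOfLE hMS
  let e := (eL.trans (Equiv.prodCongr (Equiv.refl _) f)).trans eM.symm
  refine ⟨e, fun a => ?_⟩
  have hfst : (eM (e a)).1 = (eL a).1 := by simp [e]
  generalize e a = b at hfst ⊢
  induction a using QuotientAddGroup.induction_on with | H x => ?_
  induction b using QuotientAddGroup.induction_on with | H y => ?_
  have hxy : (y : G ⧸ (L ⊔ M)) = (x : G ⧸ (L ⊔ M)) := hfst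
  obtain ⟨l, hl, m, hm, hlm⟩ := AddSubgroup.mem_sup.1 (QuotientAddGroup.eq.1 hxy)
  refine ⟨x - l, QuotientAddGroup.eq.2 ?_, QuotientAddGroup.eq.2 ?_⟩
  · simpa using hl
  · have : -(x - l) + y = -m := by
      rw [eq_add_of_neg_add_eq hlm.symm]
      abel
    rw [this]
    exact M.neg_mem hm

/-- A set containing exactly one representative of each coset of `H` tiles with `H`. -/
lemma existsUnique_add_of_bijective_mk {G : Type*} [AddCommGroup G] (H : AddSubgroup G)
    (F : Finset G) (hF : Function.Bijective fun f : F => ((f : G) : G ⧸ H)) (x : G) :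
    ∃! p : H × F, x = (p.1 : G) + (p.2 : G) := by
  obtain ⟨f, hf⟩ := hF.2 (x : G ⧸ H)
  refine ⟨(⟨-f + x, QuotientAddGroup.eq.1 hf⟩, f), by simp, ?_⟩
  rintro ⟨h, f'⟩ hx
  have hf' : f' = f := hF.1 <| hf.symm ▸ QuotientAddGroup.eq.2 (by simp [hx])
  subst hf'
  ext
  · simp [hx]
  · rfl

/-- If `L` and `M` are subgroups of `ℤ^d` of the same finite index `k`, then there is a
finite set `F ⊆ ℤ^d` of cardinality `k` such that `L ⊕ F = ℤ^d` and `M ⊕ F = ℤ^d` are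
both tilings: every element of `ℤ^d` is uniquely a sum of an element of `L` and an
element of `F`, and likewise for `M`. -/
theorem common_fundamental_domain_in_Zd
    (d k : ℕ) (hk : 0 < k) (L M : AddSubgroup (Fin d → ℤ))
    (hL : L.index = k) (hM : M.index = k) :
    ∃ F : Finset (Fin d → ℤ), F.card = k ∧
      (∀ x : Fin d → ℤ, ∃! p : L × F, x = (p.1 : Fin d → ℤ) + (p.2 : Fin d → ℤ)) ∧
      (∀ x : Fin d → ℤ, ∃! p : M × F, x = (p.1 : Fin d → ℤ) + (p.2 : Fin d → ℤ)) := by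
  classical
  obtain ⟨e, he⟩ := exists_quotient_equiv_with_common_representatives L M
    (hL ▸ hk.ne') (hL.trans hM.symm)
  choose s hsL hsM using he
  have : Finite ((Fin d → ℤ) ⧸ L) := Nat.finite_of_card_ne_zero (hL ▸ hk.ne' : L.index ≠ 0)
  have := Fintype.ofFinite ((Fin d → ℤ) ⧸ L)
  have hs : Function.Injective s := Function.LeftInverse.injective hsL
  let F : Finset (Fin d → ℤ) := Finset.univ.image s
  have hbL : Function.Bijective fun f : F => ((f : Fin d → ℤ) : (Fin d → ℤ) ⧸ L) := by
    refine ⟨?_, fun a => ⟨⟨s a, Finset.mem_image_of_mem s (Finset.mem_univ a)⟩, hsL a⟩⟩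
    rintro ⟨f, hf⟩ ⟨g, hg⟩ hfg
    obtain ⟨a, -, rfl⟩ := Finset.mem_image.1 hf
    obtain ⟨b, -, rfl⟩ := Finset.mem_image.1 hg
    simp_all
  have hbM : Function.Bijective fun f : F => ((f : Fin d → ℤ) : (Fin d → ℤ) ⧸ M) := by
    convert e.bijective.comp hbL using 1
    funext ⟨f, hf⟩
    obtain ⟨a, -, rfl⟩ := Finset.mem_image.1 hf
    simp [hsL, hsM]
  refine ⟨F, ?_, existsUnique_add_of_bijective_mk L F hbL, existsUnique_add_of_bijective_mk M F hbM⟩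
  rw [Finset.card_image_of_injective _ hs, Finset.card_univ, ← Nat.card_eq_fintype_card]
  exact hL
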